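/- Under Assumption (A): (i) for every parameter vector η with all components positive and each i = 1, …, n, the functional ψ_i attains both its minimum and its maximum over M_η, i.e., there exist x_i⁺, x_i⁻ ∈ M_η with ψ_i(x_i⁺) = min_{x ∈ M_η} ψ_i(x) and ψ_i(x_i⁻) = max_{x ∈ M_η} ψ_i(x); (ii) if for every η with all components positive one has ψ_i(x) = ψ_i(x̂) for all x, x̂ ∈ M_η, then ∂_iF(η) exists (∂_i⁻F(η) = ∂_i⁺F(η)) at every such η, and for each such η the map h ↦ ∂_iF(η + h e_i) is continuous at h = 0. -/

import Mathlib

open Filter Set Topology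

/-- The value function `F(η) = inf_{x ∈ Q} (φ(x) + Σ_i η_i ψ_i(x))` of
multi-parameter Tikhonov regularization. -/
noncomputable def valueFun {X : Type*} {n : ℕ} (Q : Set X) (φ : X → ℝ)
    (ψ : Fin n → X → ℝ) (η : Fin n → ℝ) : ℝ :=
  sInf ((fun x => φ x + ∑ i, η i * ψ i x) '' Q)

/-- `HasDPlus F η i D` says that the right-sided partial derivative
`∂_i⁺F(η) = lim_{h→0⁺} (F(η + h eᵢ) - F(η))/h` exists and equals `D`. -/
def HasDPlus {n : ℕ} (F : (Fin n → ℝ) → ℝ) (η : Fin n → ℝ) (i : Fin n) (D : ℝ) : Prop :=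
  Filter.Tendsto (fun h : ℝ => (F (η + h • (Pi.single i 1 : Fin n → ℝ)) - F η) / h)
    (nhdsWithin 0 (Set.Ioi 0)) (nhds D)

/-- `HasDMinus F η i D` says that the left-sided partial derivative
`∂_i⁻F(η) = lim_{h→0⁺} (F(η) - F(η - h eᵢ))/h` exists and equals `D`. -/
def HasDMinus {n : ℕ} (F : (Fin n → ℝ) → ℝ) (η : Fin n → ℝ) (i : Fin n) (D : ℝ) : Prop :=
  Filter.Tendsto (fun h : ℝ => (F η - F (η - h • (Pi.single i 1 : Fin n → ℝ))) / h)
    (nhdsWithin 0 (Set.Ioi 0)) (nhds D)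

/-- The set `M_η` of minimizers of the Tikhonov functional `J_η` over `Q`. -/
def minSet {X : Type*} {n : ℕ} (Q : Set X) (φ : X → ℝ) (ψ : Fin n → X → ℝ)
    (η : Fin n → ℝ) : Set X :=
  {x | x ∈ Q ∧ ∀ z ∈ Q, φ x + ∑ i, η i * ψ i x ≤ φ z + ∑ i, η i * ψ i z}

/-- If `a + b` is the limit of `f + g`, while `a` and `b` are asymptotic lower bounds of
`f` and `g`, then `f` tends to `a`. -/
theorem tendsto_of_tendsto_add_of_eventually_sub_lt {α : Type*} {l : Filter α}
    {f g : α → ℝ} {a b : ℝ}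
    (hf : ∀ ε > 0, ∀ᶠ k in l, a - ε < f k) (hg : ∀ ε > 0, ∀ᶠ k in l, b - ε < g k)
    (h : Tendsto (fun k => f k + g k) l (𝓝 (a + b))) : Tendsto f l (𝓝 a) := by
  rw [Metric.tendsto_nhds] at h ⊢
  intro ε hε
  filter_upwards [hf ε hε, hg (ε / 2) (half_pos hε), h (ε / 2) (half_pos hε)] with k h1 h2 h3
  rw [Real.dist_eq, abs_lt] at h3 ⊢
  constructor <;> linarith

/-- Asymptotic lower bounds add up under finite sums with nonnegative weights. -/
theorem eventually_sub_lt_weighted_sum {α ι : Type*} {l : Filter α} (s : Finset ι)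
    {w : ι → ℝ} (hw : ∀ i, 0 < w i) {f : ι → α → ℝ} {a : ι → ℝ}
    (hf : ∀ i, ∀ ε > 0, ∀ᶠ k in l, a i - ε < f i k) :
    ∀ ε > 0, ∀ᶠ k in l, ∑ i ∈ s, w i * a i - ε < ∑ i ∈ s, w i * f i k := by
  classical
  induction s using Finset.induction_on with
  | empty =>
    intro ε hε
    simpa using Eventually.of_forall fun _ => hε
  | insert i s his ih =>
    intro ε hε
    filter_upwards [ih (ε / 2) (half_pos hε), hf i (ε / 2 / w i) (div_pos (half_pos hε) (hw i))]
      with k h1 h2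
    rw [Finset.sum_insert his, Finset.sum_insert his]
    have h3 := mul_lt_mul_of_pos_left h2 (hw i)
    rw [mul_sub, mul_div_cancel₀ _ (hw i).ne'] at h3
    linarith

/-- Sequences minimizing the Tikhonov functional subconverge to a minimizer, together with the
values of all penalties. -/
theorem exists_minSet_subseq_tendsto
    {X : Type*} [TopologicalSpace X] {n : ℕ} {Q : Set X}
    {φ : X → ℝ} (hφ : ∀ x, 0 ≤ φ x)
    {ψ : Fin n → X → ℝ} (hψ : ∀ i x, 0 ≤ ψ i x)
    (hcpt : ∀ u : ℕ → X, (∀ k, u k ∈ Q) →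
      (∃ C : ℝ, ∀ k, φ (u k) ≤ C ∧ ∀ i, ψ i (u k) ≤ C) →
      ∃ xs ∈ Q, ∃ σ : ℕ → ℕ, StrictMono σ ∧ Tendsto (u ∘ σ) atTop (𝓝 xs))
    (hlscφ : ∀ (u : ℕ → X) (x : X), (∀ k, u k ∈ Q) → x ∈ Q → Tendsto u atTop (𝓝 x) →
      φ x ≤ liminf (fun k => φ (u k)) atTop)
    (hlscψ : ∀ (i : Fin n) (u : ℕ → X) (x : X), (∀ k, u k ∈ Q) → x ∈ Q →
      Tendsto u atTop (𝓝 x) → ψ i x ≤ liminf (fun k => ψ i (u k)) atTop)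
    {η : Fin n → ℝ} (hη : ∀ j, 0 < η j) {u : ℕ → X} (hu : ∀ k, u k ∈ Q) {m : ℝ}
    (hm : ∀ z ∈ Q, m ≤ φ z + ∑ i, η i * ψ i z)
    (hum : Tendsto (fun k => φ (u k) + ∑ i, η i * ψ i (u k)) atTop (𝓝 m)) :
    ∃ x ∈ minSet Q φ ψ η, ∃ σ : ℕ → ℕ, StrictMono σ ∧
      ∀ i, Tendsto (fun k => ψ i (u (σ k))) atTop (𝓝 (ψ i x)) := by
  classical
  obtain ⟨C, hC⟩ := hum.bddAbove_range
  have hC' : ∀ k, φ (u k) + ∑ i, η i * ψ i (u k) ≤ C := fun k => hC ⟨k, rfl⟩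
  have hterm : ∀ x i, 0 ≤ η i * ψ i x := fun x i => mul_nonneg (hη i).le (hψ i x)
  have hle : ∀ k i, ψ i (u k) ≤ C / η i := fun k i => by
    rw [le_div_iff₀ (hη i), mul_comm]
    have h1 := Finset.single_le_sum (fun j _ => hterm (u k) j) (Finset.mem_univ i)
    linarith [hC' k, hφ (u k)]
  have hleφ : ∀ k, φ (u k) ≤ C := fun k => by
    have h1 := Finset.sum_nonneg (s := Finset.univ) (fun j _ => hterm (u k) j)
    linarith [hC' k]
  have hC0 : 0 ≤ C := (hφ _).trans (hleφ 0)
  have hdiv : ∀ i, 0 ≤ C / η i := fun i => div_nonneg hC0 (hη i).le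
  obtain ⟨x, hxQ, σ, hσ, hx⟩ := hcpt u hu ⟨C + ∑ i, C / η i, fun k =>
    ⟨(hleφ k).trans (le_add_of_nonneg_right (Finset.sum_nonneg fun i _ => hdiv i)), fun i =>
      (hle k i).trans ((Finset.single_le_sum (fun j _ => hdiv j) (Finset.mem_univ i)).trans
        (le_add_of_nonneg_left hC0))⟩⟩
  have lφ : ∀ ε > 0, ∀ᶠ k in atTop, φ x - ε < φ (u (σ k)) := fun ε hε =>
    eventually_lt_of_lt_liminf
      ((sub_lt_self _ hε).trans_le (hlscφ (u ∘ σ) x (fun k => hu _) hxQ hx))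
      (isBoundedUnder_of ⟨0, fun k => hφ _⟩)
  have lψ : ∀ i, ∀ ε > 0, ∀ᶠ k in atTop, ψ i x - ε < ψ i (u (σ k)) := fun i ε hε =>
    eventually_lt_of_lt_liminf
      ((sub_lt_self _ hε).trans_le (hlscψ i (u ∘ σ) x (fun k => hu _) hxQ hx))
      (isBoundedUnder_of ⟨0, fun k => hψ i _⟩)
  have lrest : ∀ s : Finset (Fin n), ∀ ε > 0, ∀ᶠ k in atTop,
      φ x + ∑ i ∈ s, η i * ψ i x - ε < φ (u (σ k)) + ∑ i ∈ s, η i * ψ i (u (σ k)) := by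
    intro s ε hε
    filter_upwards [lφ _ (half_pos hε),
      eventually_sub_lt_weighted_sum s hη lψ _ (half_pos hε)] with k h1 h2
    linarith
  have humσ := hum.comp hσ.tendsto_atTop
  have hxm : φ x + ∑ i, η i * ψ i x = m := by
    refine le_antisymm (le_of_forall_pos_sub_le fun ε hε => ?_) (hm x hxQ)
    exact ge_of_tendsto humσ ((lrest Finset.univ ε hε).mono fun k hk => hk.le)
  refine ⟨x, ⟨hxQ, fun z hz => hxm.trans_le (hm z hz)⟩, σ, hσ, fun i => ?_⟩
  have hsplit : ∀ z, η i * ψ i z + (φ z + ∑ j ∈ Finset.univ.erase i, η j * ψ j z) =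
      φ z + ∑ j, η j * ψ j z := fun z => by
    rw [← Finset.add_sum_erase _ _ (Finset.mem_univ i)]
    ring
  have key : Tendsto (fun k => η i * ψ i (u (σ k))) atTop (𝓝 (η i * ψ i x)) := by
    refine tendsto_of_tendsto_add_of_eventually_sub_lt ?_ (lrest (Finset.univ.erase i)) ?_
    · simpa using eventually_sub_lt_weighted_sum {i} hη lψ
    · simp only [hsplit, hxm]
      exact humσ
  simpa [← mul_assoc, inv_mul_cancel₀ (hη i).ne'] using key.const_mul (η i)⁻¹

/-- The infimum is attained at minimizers. -/
theorem valueFun_eq_of_mem_minSet {X : Type*} {n : ℕ} {Q : Set X} {φ : X → ℝ}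
    {ψ : Fin n → X → ℝ} {η : Fin n → ℝ} {x : X} (hx : x ∈ minSet Q φ ψ η) :
    valueFun Q φ ψ η = φ x + ∑ i, η i * ψ i x := by
  refine IsLeast.csInf_eq ⟨⟨x, hx.1, rfl⟩, ?_⟩
  rintro _ ⟨z, hz, rfl⟩
  exact hx.2 z hz

/-- The Tikhonov functional is affine along coordinate directions in the parameter. -/
theorem sum_add_smul_single_mul {n : ℕ} (η : Fin n → ℝ) (h : ℝ) (i : Fin n) (a : Fin n → ℝ) :
    ∑ j, (η + h • (Pi.single i 1 : Fin n → ℝ)) j * a j = ∑ j, η j * a j + h * a i := by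
  simp [add_mul, Finset.sum_add_distrib, Pi.single_apply]

/-- Small perturbations of a positive parameter in a coordinate direction stay positive. -/
theorem eventually_add_smul_single_pos {n : ℕ} {η : Fin n → ℝ} (hη : ∀ j, 0 < η j)
    (i : Fin n) :
    ∀ᶠ h : ℝ in 𝓝 0, ∀ j, 0 < (η + h • (Pi.single i 1 : Fin n → ℝ)) j := by
  rw [eventually_all]
  intro j
  have hc : ContinuousAt (fun h : ℝ => (η + h • (Pi.single i 1 : Fin n → ℝ)) j) 0 := by
    simp only [Pi.add_apply, Pi.smul_apply, smul_eq_mul]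
    fun_prop
  exact hc.eventually (lt_mem_nhds (by simpa using hη j))

/-- Along a selection of minimizers of the perturbed functionals, the values of the unperturbed
functional tend to its minimum. -/
theorem tendsto_value_of_perturbed_minimizers {X : Type*} {n : ℕ} {Q : Set X}
    {φ : X → ℝ} (hφ : ∀ x, 0 ≤ φ x) {ψ : Fin n → X → ℝ} (hψ : ∀ i x, 0 ≤ ψ i x)
    {s : (Fin n → ℝ) → X} (hs : ∀ η, (∀ j, 0 < η j) → s η ∈ minSet Q φ ψ η)
    {η : Fin n → ℝ} (hη : ∀ j, 0 < η j) (i : Fin n) :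
    Tendsto (fun h : ℝ => φ (s (η + h • (Pi.single i 1 : Fin n → ℝ))) +
        ∑ j, η j * ψ j (s (η + h • (Pi.single i 1 : Fin n → ℝ)))) (𝓝 0)
      (𝓝 (φ (s η) + ∑ j, η j * ψ j (s η))) := by
  set m := φ (s η) + ∑ j, η j * ψ j (s η) with hm
  set c := ψ i (s η) with hc
  set B := (m + η i / 2 * c) / (η i / 2) with hB
  have hi := hη i
  have hlim : Tendsto (fun h : ℝ => m + |h| * (c + B)) (𝓝 0) (𝓝 m) := by
    have : ContinuousAt (fun h : ℝ => m + |h| * (c + B)) 0 := by fun_prop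
    simpa [ContinuousAt] using this
  have hpos := eventually_add_smul_single_pos hη i
  refine tendsto_of_tendsto_of_tendsto_of_le_of_le' tendsto_const_nhds hlim ?_ ?_
  · filter_upwards [hpos] with h hh
    exact (hs η hη).2 _ (hs _ hh).1
  · have hsmall : ∀ᶠ h : ℝ in 𝓝 0, |h| < η i / 2 := by
      simpa using (continuous_abs.tendsto (0 : ℝ)).eventually
        (gt_mem_nhds (by simpa using half_pos hi))
    filter_upwards [hpos, hsmall] with h hh hsm
    have h1 := (hs _ hh).2 _ (hs η hη).1
    rw [sum_add_smul_single_mul, sum_add_smul_single_mul] at h1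
    set y := s (η + h • (Pi.single i 1 : Fin n → ℝ))
    have hsingle : η i * ψ i y ≤ ∑ j, η j * ψ j y :=
      Finset.single_le_sum (f := fun j => η j * ψ j y)
        (fun j _ => mul_nonneg (hη j).le (hψ j y)) (Finset.mem_univ i)
    have hc0 : 0 ≤ c := hψ i _
    have hy0 := hψ i y
    have hφy := hφ y
    have hab := abs_lt.1 hsm
    have hyB : ψ i y ≤ B := by
      rw [hB, le_div_iff₀ (half_pos hi)]
      nlinarith
    have e1 : h * c ≤ |h| * c := mul_le_mul_of_nonneg_right (le_abs_self h) hc0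
    have e2 : -h * ψ i y ≤ |h| * ψ i y := mul_le_mul_of_nonneg_right (neg_le_abs h) hy0
    have e3 : |h| * ψ i y ≤ |h| * B := mul_le_mul_of_nonneg_left hyB (abs_nonneg h)
    linarith

/-- The one-sided partial derivatives of the value function are given by the penalty at the
minimizers, provided the penalty depends continuously on the parameter along a selection. -/
theorem hasDMinus_and_hasDPlus_valueFun {X : Type*} {n : ℕ} {Q : Set X}
    {φ : X → ℝ} {ψ : Fin n → X → ℝ}
    {s : (Fin n → ℝ) → X} (hs : ∀ η, (∀ j, 0 < η j) → s η ∈ minSet Q φ ψ η)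
    {η : Fin n → ℝ} (hη : ∀ j, 0 < η j) (i : Fin n)
    (hcont : Tendsto (fun h : ℝ => ψ i (s (η + h • (Pi.single i 1 : Fin n → ℝ)))) (𝓝 0)
      (𝓝 (ψ i (s η)))) :
    HasDMinus (valueFun Q φ ψ) η i (ψ i (s η)) ∧
      HasDPlus (valueFun Q φ ψ) η i (ψ i (s η)) := by
  have hpos := eventually_add_smul_single_pos hη i
  have bound : ∀ h : ℝ, (∀ j, 0 < (η + h • (Pi.single i 1 : Fin n → ℝ)) j) →
      h * ψ i (s (η + h • (Pi.single i 1 : Fin n → ℝ))) ≤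
        valueFun Q φ ψ (η + h • (Pi.single i 1 : Fin n → ℝ)) - valueFun Q φ ψ η ∧
      valueFun Q φ ψ (η + h • (Pi.single i 1 : Fin n → ℝ)) - valueFun Q φ ψ η ≤
        h * ψ i (s η) := by
    intro h hh
    have h1 := (hs _ hh).2 _ (hs η hη).1
    have h2 := (hs η hη).2 _ (hs _ hh).1
    rw [valueFun_eq_of_mem_minSet (hs _ hh), valueFun_eq_of_mem_minSet (hs η hη)]
    rw [sum_add_smul_single_mul] at h1 ⊢
    rw [sum_add_smul_single_mul] at h1
    constructor <;> linarith
  have hneg : Tendsto (fun h : ℝ => -h) (𝓝[>] 0) (𝓝 0) := by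
    simpa using (continuous_neg.tendsto (0 : ℝ)).mono_left nhdsWithin_le_nhds
  constructor
  · refine tendsto_of_tendsto_of_tendsto_of_le_of_le' tendsto_const_nhds
      (hcont.comp hneg) ?_ ?_
    · filter_upwards [hneg.eventually hpos, self_mem_nhdsWithin] with h hh h0
      have hb := (bound (-h) hh).2
      rw [le_div_iff₀ h0, sub_eq_add_neg η, ← neg_smul]
      linarith
    · filter_upwards [hneg.eventually hpos, self_mem_nhdsWithin] with h hh h0
      have hb := (bound (-h) hh).1
      rw [div_le_iff₀ h0, sub_eq_add_neg η, ← neg_smul, Function.comp_apply]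
      linarith
  · refine tendsto_of_tendsto_of_tendsto_of_le_of_le'
      (hcont.mono_left nhdsWithin_le_nhds) tendsto_const_nhds ?_ ?_
    · filter_upwards [nhdsWithin_le_nhds hpos, self_mem_nhdsWithin] with h hh h0
      rw [le_div_iff₀ h0, mul_comm]
      exact (bound h hh).1
    · filter_upwards [nhdsWithin_le_nhds hpos, self_mem_nhdsWithin] with h hh h0
      rw [div_le_iff₀ h0, mul_comm]
      exact (bound h hh).2

/-- under Assumption (A): (i) each `ψ i` attains its minimum and maximum
over `M_η` for every positive `η`; (ii) if `ψ i` is single valued on `M_η` for every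
positive `η`, then `∂_iF(η)` exists at every positive `η` (both one-sided derivatives
agree) and `h ↦ ∂_iF(η + h eᵢ)` is continuous at `h = 0`. -/
theorem psi_extrema_and_differentiability
    {X : Type*} [TopologicalSpace X] {n : ℕ} (Q : Set X) (hQ : Q.Nonempty)
    (φ : X → ℝ) (hφ : ∀ x, 0 ≤ φ x)
    (ψ : Fin n → X → ℝ) (hψ : ∀ i x, 0 ≤ ψ i x)
    -- Assumption (A)(i): sequential compactness
    (hcpt : ∀ u : ℕ → X, (∀ k, u k ∈ Q) →
      (∃ C : ℝ, ∀ k, φ (u k) ≤ C ∧ ∀ i, ψ i (u k) ≤ C) →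
      ∃ xs ∈ Q, ∃ σ : ℕ → ℕ, StrictMono σ ∧
        Filter.Tendsto (u ∘ σ) Filter.atTop (nhds xs))
    -- Assumption (A)(ii): sequential lower semicontinuity
    (hlscφ : ∀ (u : ℕ → X) (x : X), (∀ k, u k ∈ Q) → x ∈ Q →
      Filter.Tendsto u Filter.atTop (nhds x) →
      φ x ≤ Filter.liminf (fun k => φ (u k)) Filter.atTop)
    (hlscψ : ∀ (i : Fin n) (u : ℕ → X) (x : X), (∀ k, u k ∈ Q) → x ∈ Q →
      Filter.Tendsto u Filter.atTop (nhds x) →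
      ψ i x ≤ Filter.liminf (fun k => ψ i (u k)) Filter.atTop) :
    -- (i) ψ i attains its min and max over M_η
    (∀ (η : Fin n → ℝ), (∀ j, 0 < η j) → ∀ i : Fin n,
      ∃ xp ∈ minSet Q φ ψ η, ∃ xm ∈ minSet Q φ ψ η,
        ∀ z ∈ minSet Q φ ψ η, ψ i xp ≤ ψ i z ∧ ψ i z ≤ ψ i xm) ∧
    -- (ii) single-valuedness implies existence and continuity of ∂_iF
    (∀ i : Fin n,
      (∀ (η : Fin n → ℝ), (∀ j, 0 < η j) →
        ∀ x ∈ minSet Q φ ψ η, ∀ x' ∈ minSet Q φ ψ η, ψ i x = ψ i x') →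
      (∀ (η : Fin n → ℝ), (∀ j, 0 < η j) →
        ∃ D : ℝ, HasDMinus (valueFun Q φ ψ) η i D ∧ HasDPlus (valueFun Q φ ψ) η i D) ∧
      (∀ D : (Fin n → ℝ) → ℝ,
        (∀ (η : Fin n → ℝ), (∀ j, 0 < η j) →
          HasDMinus (valueFun Q φ ψ) η i (D η) ∧ HasDPlus (valueFun Q φ ψ) η i (D η)) →
        ∀ (η : Fin n → ℝ), (∀ j, 0 < η j) →
          ContinuousAt (fun h : ℝ => D (η + h • (Pi.single i 1 : Fin n → ℝ))) 0)) := by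
  have hsub : ∀ {η : Fin n → ℝ}, (∀ j, 0 < η j) → ∀ {u : ℕ → X}, (∀ k, u k ∈ Q) → ∀ {m : ℝ},
      (∀ z ∈ Q, m ≤ φ z + ∑ i, η i * ψ i z) →
      Tendsto (fun k => φ (u k) + ∑ i, η i * ψ i (u k)) atTop (𝓝 m) →
      ∃ x ∈ minSet Q φ ψ η, ∃ σ : ℕ → ℕ, StrictMono σ ∧
        ∀ i, Tendsto (fun k => ψ i (u (σ k))) atTop (𝓝 (ψ i x)) :=
    fun hη _ hu _ hm hum => exists_minSet_subseq_tendsto hφ hψ hcpt hlscφ hlscψ hη hu hm hum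
  have hex : ∀ η : Fin n → ℝ, (∀ j, 0 < η j) → (minSet Q φ ψ η).Nonempty := by
    intro η hη
    have hbdd : BddBelow ((fun x => φ x + ∑ i, η i * ψ i x) '' Q) := by
      refine ⟨0, ?_⟩
      rintro _ ⟨z, -, rfl⟩
      exact add_nonneg (hφ z) (Finset.sum_nonneg fun i _ => mul_nonneg (hη i).le (hψ i z))
    obtain ⟨v, -, hv, hvQ⟩ := exists_seq_tendsto_sInf (hQ.image _) hbdd
    choose u hu huv using hvQ
    obtain ⟨x, hx, -⟩ := hsub hη hu (fun z hz => csInf_le hbdd ⟨z, hz, rfl⟩)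
      (hv.congr fun k => (huv k).symm)
    exact ⟨x, hx⟩
  have hsel : ∀ η : Fin n → ℝ, ∃ x ∈ Q, (∀ j, 0 < η j) → x ∈ minSet Q φ ψ η := by
    intro η
    by_cases hη : ∀ j, 0 < η j
    · obtain ⟨x, hx⟩ := hex η hη
      exact ⟨x, hx.1, fun _ => hx⟩
    · obtain ⟨x, hx⟩ := hQ
      exact ⟨x, hx, fun h => absurd h hη⟩
  choose s hsQ hs using hsel
  refine ⟨fun η hη i => ?_, fun i huniq => ?_⟩
  · have attain : ∀ {v : ℕ → ℝ} {a : ℝ}, Tendsto v atTop (𝓝 a) →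
        (∀ k, v k ∈ ψ i '' minSet Q φ ψ η) → ∃ x ∈ minSet Q φ ψ η, ψ i x = a := by
      intro v a hv hmem
      choose u hu huv using hmem
      have hconst : ∀ k, φ (u k) + ∑ j, η j * ψ j (u k) = valueFun Q φ ψ η :=
        fun k => (valueFun_eq_of_mem_minSet (hu k)).symm
      obtain ⟨x, hx, σ, hσ, hlim⟩ := hsub hη (fun k => (hu k).1)
        (fun z hz => (hconst 0).symm.trans_le ((hu 0).2 z hz))
        (tendsto_const_nhds.congr fun k => (hconst k).symm)
      refine ⟨x, hx, tendsto_nhds_unique (hlim i) ?_⟩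
      simpa only [huv, Function.comp_def] using hv.comp hσ.tendsto_atTop
    have hne := (hex η hη).image (ψ i)
    have hbelow : BddBelow (ψ i '' minSet Q φ ψ η) := by
      refine ⟨0, ?_⟩
      rintro _ ⟨z, -, rfl⟩
      exact hψ i z
    have habove : BddAbove (ψ i '' minSet Q φ ψ η) := by
      refine ⟨valueFun Q φ ψ η / η i, ?_⟩
      rintro _ ⟨z, hz, rfl⟩
      rw [le_div_iff₀ (hη i), mul_comm, valueFun_eq_of_mem_minSet hz]
      exact (Finset.single_le_sum (f := fun j => η j * ψ j z)
        (fun j _ => mul_nonneg (hη j).le (hψ j z)) (Finset.mem_univ i)).trans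
        (le_add_of_nonneg_left (hφ z))
    obtain ⟨v, -, hv, hvmem⟩ := exists_seq_tendsto_sInf hne hbelow
    obtain ⟨w, -, hw, hwmem⟩ := exists_seq_tendsto_sSup hne habove
    obtain ⟨xp, hxp, hxp'⟩ := attain hv hvmem
    obtain ⟨xm, hxm, hxm'⟩ := attain hw hwmem
    exact ⟨xp, hxp, xm, hxm, fun z hz =>
      ⟨hxp'.trans_le (csInf_le hbelow ⟨z, hz, rfl⟩),
        (le_csSup habove ⟨z, hz, rfl⟩).trans_eq hxm'.symm⟩⟩
  · have hcont : ∀ η : Fin n → ℝ, (∀ j, 0 < η j) →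
        Tendsto (fun h : ℝ => ψ i (s (η + h • (Pi.single i 1 : Fin n → ℝ)))) (𝓝 0)
          (𝓝 (ψ i (s η))) := by
      intro η hη
      refine tendsto_of_subseq_tendsto fun t ht => ?_
      obtain ⟨x, hx, σ, -, hlim⟩ := hsub hη (fun k => hsQ _) (hs η hη).2
        ((tendsto_value_of_perturbed_minimizers hφ hψ hs hη i).comp ht)
      refine ⟨σ, ?_⟩
      rw [huniq η hη (s η) (hs η hη) x hx]
      exact hlim i
    have hder := fun (η : Fin n → ℝ) (hη : ∀ j, 0 < η j) =>
      hasDMinus_and_hasDPlus_valueFun hs hη i (hcont η hη)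
    refine ⟨fun η hη => ⟨_, hder η hη⟩, fun D hD η hη => ?_⟩
    have hDs : ∀ η : Fin n → ℝ, (∀ j, 0 < η j) → ψ i (s η) = D η := fun η hη =>
      tendsto_nhds_unique (hder η hη).2 (hD η hη).2
    have hc := (hcont η hη).congr' ((eventually_add_smul_single_pos hη i).mono
      fun h hh => hDs _ hh)
    rw [hDs η hη] at hc
    simpa [ContinuousAt] using hc
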